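/- For every L > 1 there exists a constant c > 0 such that for all j ∈ ℤ and all x ∈ ℝ, Σ_{k∈ℤ} √(log(3 + |j| + |k|)) / (3 + |2^j x − k|)^L ≤ c √(log(3 + |j| + 2^j |x|)). -/

import Mathlib

theorem summable_one_add_abs_int_rpow {s : ℝ} (hs : 1 < s) :
    Summable fun k : ℤ => (1 + |(k : ℝ)|) ^ (-s) := by
  have h : Summable fun n : ℕ => (1 + (n : ℝ)) ^ (-s) := by
    have h0 := (summable_nat_add_iff 1).2 (Real.summable_nat_rpow.2 (neg_lt_neg hs))
    simpa [add_comm] using h0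
  apply Summable.of_nat_of_neg <;> simpa using h

theorem sqrt_one_add_log_le {t δ : ℝ} (ht : 1 ≤ t) (hδ : 0 < δ) :
    √(1 + Real.log t) ≤ √(1 + 1 / δ) * t ^ (δ / 2) := by
  have h0 : 0 ≤ t := by linarith
  have h1 : 1 ≤ t ^ δ := Real.one_le_rpow ht hδ.le
  have h2 := Real.log_le_rpow_div h0 hδ
  have h3 : t ^ (δ / 2) = √(t ^ δ) := by
    rw [Real.sqrt_eq_rpow, ← Real.rpow_mul h0]
    ring_nf
  rw [h3, ← Real.sqrt_mul (by positivity)]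
  apply Real.sqrt_le_sqrt
  calc 1 + Real.log t ≤ t ^ δ + t ^ δ / δ := add_le_add h1 h2
    _ = (1 + 1 / δ) * t ^ δ := by ring

theorem sqrt_log_add_le {a u : ℝ} (b y : ℝ) (ha : 0 ≤ a) (hu : u = 3 + |y - b|) :
    √(Real.log (3 + a + |b|)) ≤ √(Real.log (3 + a + |y|)) * √(1 + Real.log u) := by
  have hb : |b| ≤ |y| + |y - b| := by
    have := abs_sub y (y - b)
    simpa using this
  have hy := abs_nonneg y
  have hyb := abs_nonneg (y - b)
  have hA : 1 ≤ Real.log (3 + a + |y|) := by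
    rw [Real.le_log_iff_exp_le (by positivity)]
    linarith [Real.exp_one_lt_d9]
  have hu0 : 0 ≤ Real.log u := Real.log_nonneg (by linarith)
  rw [← Real.sqrt_mul (by linarith)]
  apply Real.sqrt_le_sqrt
  calc Real.log (3 + a + |b|) ≤ Real.log ((3 + a + |y|) * u) := by
        apply Real.log_le_log (by positivity)
        rw [hu]
        nlinarith
    _ = Real.log (3 + a + |y|) + Real.log u :=
        Real.log_mul (by positivity) (by rw [hu]; positivity)
    _ ≤ Real.log (3 + a + |y|) * (1 + Real.log u) := by nlinarith

theorem three_add_abs_rpow_neg_le {s : ℝ} (hs : 0 ≤ s) (y : ℝ) (k : ℤ) :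
    (3 + |y - k|) ^ (-s) ≤ (1 + |((k - ⌊y⌋ : ℤ) : ℝ)|) ^ (-s) := by
  apply Real.rpow_le_rpow_of_nonpos (by positivity) _ (by linarith)
  push_cast
  have h1 := Int.floor_le y
  have h2 := Int.lt_floor_add_one y
  have h3 : |(k : ℝ) - ⌊y⌋| ≤ |y - k| + 1 := by
    rw [abs_le]
    constructor <;> linarith [le_abs_self (y - k), neg_abs_le (y - k)]
  linarith

theorem stmt2 (L : ℝ) (hL : 1 < L) :
    ∃ c > (0 : ℝ), ∀ (j : ℤ) (x : ℝ),
      (∑' k : ℤ, Real.sqrt (Real.log (3 + |(j : ℝ)| + |(k : ℝ)|)) /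
          (3 + |(2 : ℝ) ^ j * x - (k : ℝ)|) ^ L)
        ≤ c * Real.sqrt (Real.log (3 + |(j : ℝ)| + (2 : ℝ) ^ j * |x|)) := by
  set s : ℝ := (L + 1) / 2 with hs
  have hS := summable_one_add_abs_int_rpow (s := s) (by linarith)
  have hpos : 0 < ∑' k : ℤ, (1 + |(k : ℝ)|) ^ (-s) :=
    hS.tsum_pos (fun k => by positivity) 0 (by positivity)
  have hδ : 0 < L - 1 := by linarith
  refine ⟨√(1 + 1 / (L - 1)) * ∑' k : ℤ, (1 + |(k : ℝ)|) ^ (-s), by positivity, fun j x => ?_⟩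
  have hy : (2 : ℝ) ^ j * |x| = |(2 : ℝ) ^ j * x| := by
    rw [abs_mul, abs_of_pos (zpow_pos (two_pos : (0 : ℝ) < 2) j)]
  rw [hy]
  generalize (2 : ℝ) ^ j * x = y
  set A := √(Real.log (3 + |(j : ℝ)| + |y|))
  have hterm (k : ℤ) : √(Real.log (3 + |(j : ℝ)| + |(k : ℝ)|)) / (3 + |y - (k : ℝ)|) ^ L ≤
      A * √(1 + 1 / (L - 1)) * (1 + |((k - ⌊y⌋ : ℤ) : ℝ)|) ^ (-s) := by
    have ht : 0 < 3 + |y - (k : ℝ)| := by positivity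
    have hexp : (3 + |y - (k : ℝ)|) ^ ((L - 1) / 2) =
        (3 + |y - (k : ℝ)|) ^ (-s) * (3 + |y - (k : ℝ)|) ^ L := by
      rw [← Real.rpow_add ht, hs]
      ring_nf
    rw [div_le_iff₀ (by positivity)]
    calc √(Real.log (3 + |(j : ℝ)| + |(k : ℝ)|))
        ≤ A * √(1 + Real.log (3 + |y - (k : ℝ)|)) := sqrt_log_add_le _ y (abs_nonneg _) rfl
      _ ≤ A * (√(1 + 1 / (L - 1)) * (3 + |y - (k : ℝ)|) ^ ((L - 1) / 2)) := by
          gcongr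
          exact sqrt_one_add_log_le (by linarith [abs_nonneg (y - (k : ℝ))]) hδ
      _ = A * √(1 + 1 / (L - 1)) * (3 + |y - (k : ℝ)|) ^ (-s) * (3 + |y - (k : ℝ)|) ^ L := by
          rw [hexp]
          ring
      _ ≤ _ := by
          gcongr A * √(1 + 1 / (L - 1)) * ?_ * _
          exact three_add_abs_rpow_neg_le (by linarith) y k
  have hshift : Summable fun k : ℤ => (1 + |((k - ⌊y⌋ : ℤ) : ℝ)|) ^ (-s) :=
    (Equiv.subRight ⌊y⌋).summable_iff.2 hS
  have hmaj := hshift.mul_left (A * √(1 + 1 / (L - 1)))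
  have hsum := hmaj.of_nonneg_of_le (fun k => by positivity) hterm
  refine (hsum.tsum_le_tsum hterm hmaj).trans_eq ?_
  have htsum := (Equiv.subRight ⌊y⌋).tsum_eq fun k : ℤ => (1 + |(k : ℝ)|) ^ (-s)
  simp only [Equiv.subRight_apply] at htsum
  rw [tsum_mul_left, htsum]
  ring
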